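/- arXiv:math/0610212 — 6 statements merged into one kernel-verified Lean document; each statement's English description precedes it below -/
import Mathlib

section
/- Suppose V(1) < ∞ and that p ∈ X is a point with liminf_{ε→0⁺} μ(B(p,ε))/ε^n > 0 (as holds at every point of a complete Riemannian n-manifold equipped with its Riemannian volume measure). Then there exists a radius R > 0, which may be taken of the form 10^{-4s-2} for an integer s ≥ 0, such that B(p, R) is a good ball. -/
open Metric MeasureTheory ENNReal Filter Set

/-- `V1 μ` is the supremum of the measures of unit balls, `V(1) = sup_p μ(B(p,1))`. -/
noncomputable def V1 {X : Type*} [MetricSpace X] [MeasurableSpace X] (μ : Measure X) : ℝ≥0∞ :=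
  ⨆ p : X, μ (Metric.ball p 1)

/-- `B(p, R)` is a good ball: (A) reasonable growth, (B) volume bound, (C) small radius. -/
def IsGoodBall {X : Type*} [MetricSpace X] [MeasurableSpace X] (μ : Measure X) (n : ℕ)
    (p : X) (R : ℝ) : Prop :=
  μ (Metric.ball p (100 * R)) ≤ 10 ^ (4 * (n + 3)) * μ (Metric.ball p (R / 100)) ∧
  μ (Metric.ball p R) ≤ 10 ^ (2 * n + 6) * V1 μ * ENNReal.ofReal R ^ (n + 3) ∧
  R ≤ 1 / 100

lemma measure_ball_le_V1 {X : Type*} [MetricSpace X] [MeasurableSpace X] (μ : Measure X) (p : X) :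
    μ (ball p 1) ≤ V1 μ :=
  le_iSup (fun p : X => μ (ball p 1)) p

/-- A sequence that decays by a factor `q` at each of its first `s` steps decays by `q ^ s`. -/
lemma pow_mul_le_of_forall_lt {a : ℕ → ℝ≥0∞} {q : ℝ≥0∞} (s : ℕ)
    (h : ∀ t < s, q * a (t + 1) ≤ a t) : q ^ s * a s ≤ a 0 := by
  induction s with
  | zero => simp
  | succ s ih =>
    calc q ^ (s + 1) * a (s + 1) = q ^ s * (q * a (s + 1)) := by ring
      _ ≤ q ^ s * a s := by gcongr; exact h s s.lt_succ_self
      _ ≤ a 0 := ih fun t ht => h t (ht.trans s.lt_succ_self)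

lemma ofReal_ten_inv_pow (k : ℕ) :
    ENNReal.ofReal ((10 : ℝ)⁻¹ ^ k) = ((10 : ℝ≥0∞) ^ k)⁻¹ := by
  rw [ENNReal.ofReal_pow (by norm_num), ENNReal.ofReal_inv_of_pos (by norm_num),
    ENNReal.ofReal_ofNat, ENNReal.inv_pow]

lemma ten_pow_mul_inv_cancel (k : ℕ) : (10 : ℝ≥0∞) ^ k * ((10 : ℝ≥0∞) ^ k)⁻¹ = 1 :=
  ENNReal.mul_inv_cancel (pow_ne_zero _ (by norm_num)) (ENNReal.pow_ne_top (by norm_num))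

/-- If balls about `p` have measure at least of order `ε ^ n`, then the measures of the balls of
radius `10 ^ (-4 s)` cannot shrink by the factor `10 ^ (4 (n + 3))` at every scale. -/
lemma exists_measure_ball_le {X : Type*} [MetricSpace X] [MeasurableSpace X]
    (n : ℕ) (μ : Measure X) (p : X) (hfin : μ (ball p 1) ≠ ⊤)
    (hp : 0 < liminf (fun ε : ℝ => μ (ball p ε) / ENNReal.ofReal (ε ^ n))
      (nhdsWithin 0 (Ioi 0))) :
    ∃ s : ℕ, μ (ball p ((10 : ℝ)⁻¹ ^ (4 * s))) ≤
      10 ^ (4 * (n + 3)) * μ (ball p ((10 : ℝ)⁻¹ ^ (4 * (s + 1)))) := by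
  by_contra! hbad
  obtain ⟨c, hc0, hc⟩ := exists_between hp
  have hev := eventually_lt_of_lt_liminf hc
  have htend : Tendsto (fun s : ℕ => (10 : ℝ)⁻¹ ^ (4 * s)) atTop (nhdsWithin 0 (Ioi 0)) := by
    refine tendsto_nhdsWithin_iff.2 ⟨?_, Eventually.of_forall fun s => ?_⟩
    · exact (_root_.tendsto_pow_atTop_nhds_zero_of_lt_one (by norm_num) (by norm_num)).comp
        (tendsto_id.const_mul_atTop' (by norm_num))
    · exact mem_Ioi.2 (by positivity)
  obtain ⟨m, hm⟩ := ENNReal.exists_nat_gt (ENNReal.div_ne_top hfin hc0.ne')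
  obtain ⟨s, hs, hms⟩ := ((htend.eventually hev).and (eventually_ge_atTop m)).exists
  have hlow := ENNReal.mul_le_of_le_div hs.le
  rw [← pow_mul, ofReal_ten_inv_pow] at hlow
  have hup := pow_mul_le_of_forall_lt (a := fun s => μ (ball p ((10 : ℝ)⁻¹ ^ (4 * s)))) s
    fun t _ => (hbad t).le
  simp only [mul_zero, pow_zero] at hup
  have hpow : ((10 : ℝ≥0∞) ^ (4 * (n + 3))) ^ s = 10 ^ (12 * s) * 10 ^ (4 * s * n) := by
    rw [← pow_mul, ← pow_add]
    congr 1
    ring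
  have hbound : (10 : ℝ≥0∞) ^ (12 * s) * c ≤ μ (ball p 1) :=
    calc (10 : ℝ≥0∞) ^ (12 * s) * c
        = 10 ^ (12 * s) * c * (10 ^ (4 * s * n) * (10 ^ (4 * s * n))⁻¹) := by
          rw [ten_pow_mul_inv_cancel, mul_one]
      _ = (10 ^ (4 * (n + 3))) ^ s * (c * (10 ^ (4 * s * n))⁻¹) := by rw [hpow]; ring
      _ ≤ (10 ^ (4 * (n + 3))) ^ s * μ (ball p ((10 : ℝ)⁻¹ ^ (4 * s))) := by gcongr
      _ ≤ μ (ball p 1) := hup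
  have hm10 : (m : ℝ≥0∞) ≤ 10 ^ (12 * s) := by
    exact_mod_cast (hms.trans (by lia)).trans (Nat.lt_pow_self (by norm_num : 1 < 10)).le
  refine hm.not_ge (hm10.trans ?_)
  exact (ENNReal.le_div_iff_mul_le (.inl hc0.ne') (.inr hfin)).2 hbound

/-- if `V(1) < ∞` and `liminf_{ε→0⁺} μ(B(p,ε))/ε^n > 0`, then some ball
`B(p, 10^{-4s-2})` is a good ball. -/
theorem statement0 {X : Type*} [MetricSpace X] [MeasurableSpace X] [BorelSpace X]
    (n : ℕ) (hn : 1 ≤ n) (μ : Measure X) (hV : V1 μ < ⊤) (p : X)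
    (hp : 0 < Filter.liminf
      (fun ε : ℝ => μ (Metric.ball p ε) / ENNReal.ofReal (ε ^ n))
      (nhdsWithin 0 (Set.Ioi 0))) :
    ∃ s : ℕ, 0 < (10 : ℝ) ^ (-(4 * (s : ℤ)) - 2) ∧
      IsGoodBall μ n p ((10 : ℝ) ^ (-(4 * (s : ℤ)) - 2)) := by
  have hfin : μ (ball p 1) ≠ ⊤ := ((measure_ball_le_V1 μ p).trans_lt hV).ne
  have hex := exists_measure_ball_le n μ p hfin hp
  obtain ⟨s, hs, hmin⟩ : ∃ s : ℕ, μ (ball p ((10 : ℝ)⁻¹ ^ (4 * s))) ≤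
      10 ^ (4 * (n + 3)) * μ (ball p ((10 : ℝ)⁻¹ ^ (4 * (s + 1)))) ∧
      ∀ t < s, 10 ^ (4 * (n + 3)) * μ (ball p ((10 : ℝ)⁻¹ ^ (4 * (t + 1)))) ≤
        μ (ball p ((10 : ℝ)⁻¹ ^ (4 * t))) :=
    ⟨Nat.find hex, Nat.find_spec hex, fun t ht => (not_le.1 (Nat.find_min hex ht)).le⟩
  have hR : (10 : ℝ) ^ (-(4 * (s : ℤ)) - 2) = (10 : ℝ)⁻¹ ^ (4 * s + 2) := by
    rw [inv_pow, ← zpow_natCast, ← zpow_neg]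
    congr 1
    push_cast
    ring
  have hup := pow_mul_le_of_forall_lt (a := fun s => μ (ball p ((10 : ℝ)⁻¹ ^ (4 * s)))) s hmin
  simp only [mul_zero, pow_zero] at hup
  have hpow : (10 : ℝ≥0∞) ^ ((4 * s + 2) * (n + 3)) =
      10 ^ (2 * n + 6) * (10 ^ (4 * (n + 3))) ^ s := by
    rw [← pow_mul, ← pow_add]
    congr 1
    ring
  refine ⟨s, by positivity, ?_⟩
  rw [hR]
  refine ⟨?_, ?_, ?_⟩
  · have hlarge : 100 * (10 : ℝ)⁻¹ ^ (4 * s + 2) = 10⁻¹ ^ (4 * s) := by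
      rw [pow_add]
      ring
    have hsmall : (10 : ℝ)⁻¹ ^ (4 * s + 2) / 100 = 10⁻¹ ^ (4 * (s + 1)) := by
      rw [mul_add, pow_add, pow_add]
      ring
    rwa [hlarge, hsmall]
  · rw [ofReal_ten_inv_pow]
    calc μ (ball p ((10 : ℝ)⁻¹ ^ (4 * s + 2)))
        ≤ μ (ball p ((10 : ℝ)⁻¹ ^ (4 * s))) :=
          measure_mono (ball_subset_ball
            (pow_le_pow_of_le_one (by norm_num) (by norm_num) (Nat.le_add_right _ _)))
      _ = 10 ^ ((4 * s + 2) * (n + 3)) * (10 ^ ((4 * s + 2) * (n + 3)))⁻¹ *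
            μ (ball p ((10 : ℝ)⁻¹ ^ (4 * s))) := by
          rw [ten_pow_mul_inv_cancel, one_mul]
      _ = 10 ^ (2 * n + 6) * ((10 ^ (4 * (n + 3))) ^ s * μ (ball p ((10 : ℝ)⁻¹ ^ (4 * s)))) *
            (10 ^ ((4 * s + 2) * (n + 3)))⁻¹ := by rw [hpow]; ring
      _ ≤ 10 ^ (2 * n + 6) * V1 μ * (10 ^ ((4 * s + 2) * (n + 3)))⁻¹ := by
          gcongr
          exact hup.trans (measure_ball_le_V1 μ p)
      _ = 10 ^ (2 * n + 6) * V1 μ * ((10 ^ (4 * s + 2))⁻¹) ^ (n + 3) := by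
          rw [pow_mul, ENNReal.inv_pow]
  · calc (10 : ℝ)⁻¹ ^ (4 * s + 2) ≤ 10⁻¹ ^ 2 :=
          pow_le_pow_of_le_one (by norm_num) (by norm_num) (Nat.le_add_left _ _)
      _ = 1 / 100 := by norm_num
end

section
/- Suppose X is a compact metric space, μ(X) < ∞, and liminf_{ε→0⁺} μ(B(p,ε))/ε^n > 0 for every point p ∈ X (as holds for a closed Riemannian n-manifold with its volume measure). Then X admits a finite good cover. -/
open Metric MeasureTheory ENNReal Filter Set

/-- Finite Vitali selection, with no loss in the comparison of sizes. -/
theorem Finset.exists_disjoint_subfamily_meeting {ι α : Type*} (B : ι → Set α) (δ : ι → ℝ)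
    (hB : ∀ i, (B i).Nonempty) (t : Finset ι) :
    ∃ u ⊆ t, (u : Set ι).PairwiseDisjoint B ∧
      ∀ a ∈ t, ∃ b ∈ u, ¬ Disjoint (B a) (B b) ∧ δ a ≤ δ b := by
  classical
  induction t using Finset.induction_on_min_value δ with
  | empty => exact ⟨∅, by simp, by simp, by simp⟩
  | insert a s has hmin ih =>
    obtain ⟨u, hus, hdisj, hmeet⟩ := ih
    by_cases h : ∃ b ∈ u, ¬ Disjoint (B a) (B b)
    · obtain ⟨b, hbu, hb⟩ := h
      refine ⟨u, hus.trans (Finset.subset_insert a s), hdisj, fun x hx => ?_⟩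
      rcases Finset.mem_insert.1 hx with rfl | hxs
      · exact ⟨b, hbu, hb, hmin b (hus hbu)⟩
      · exact hmeet x hxs
    · push Not at h
      refine ⟨insert a u, Finset.insert_subset_insert a hus, ?_, fun x hx => ?_⟩
      · rw [Finset.coe_insert]
        exact hdisj.insert fun b hb _ => h b hb
      · rcases Finset.mem_insert.1 hx with rfl | hxs
        · exact ⟨x, Finset.mem_insert_self x u,
            fun hd => (hB x).ne_empty (disjoint_self.1 hd), le_rfl⟩
        · obtain ⟨b, hbu, hb⟩ := hmeet x hxs
          exact ⟨b, Finset.mem_insert_of_mem hbu, hb⟩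

/-- If the lower density is positive, the measure of the balls `B(p, 10^{-4k})` cannot decay
by a factor `10^{4(n+3)}` at every step. -/
theorem exists_measure_ball_le_of_liminf_pos {X : Type*} [MetricSpace X] [MeasurableSpace X]
    (μ : Measure X) [IsFiniteMeasure μ] (n : ℕ) (p : X)
    (hp : 0 < liminf (fun ε : ℝ => μ (ball p ε) / ENNReal.ofReal (ε ^ n))
      (nhdsWithin 0 (Ioi 0))) :
    ∃ k : ℕ, μ (ball p ((10 ^ 4 : ℝ)⁻¹ ^ k)) ≤
        10 ^ (4 * (n + 3)) * μ (ball p ((10 ^ 4 : ℝ)⁻¹ ^ (k + 1))) ∧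
      (10 ^ (4 * (n + 3))) ^ k * μ (ball p ((10 ^ 4 : ℝ)⁻¹ ^ k)) ≤ μ (ball p 1) := by
  classical
  have decay : ∀ k : ℕ, (∀ j < k, ¬ μ (ball p ((10 ^ 4 : ℝ)⁻¹ ^ j)) ≤
      10 ^ (4 * (n + 3)) * μ (ball p ((10 ^ 4 : ℝ)⁻¹ ^ (j + 1)))) →
      (10 ^ (4 * (n + 3))) ^ k * μ (ball p ((10 ^ 4 : ℝ)⁻¹ ^ k)) ≤ μ (ball p 1) := by
    intro k
    induction k with
    | zero => intro _; simp
    | succ k ih =>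
      intro h
      refine le_trans ?_ (ih fun j hj => h j (hj.trans k.lt_succ_self))
      rw [pow_succ, mul_assoc]
      gcongr
      exact (not_le.1 (h k k.lt_succ_self)).le
  suffices h : ∃ k : ℕ, μ (ball p ((10 ^ 4 : ℝ)⁻¹ ^ k)) ≤
      10 ^ (4 * (n + 3)) * μ (ball p ((10 ^ 4 : ℝ)⁻¹ ^ (k + 1))) from
    ⟨Nat.find h, Nat.find_spec h, decay _ fun j hj => Nat.find_min h hj⟩
  by_contra! hfail
  obtain ⟨c, hc0, hc⟩ := exists_between hp
  have hlim : Tendsto (fun k : ℕ => (10 ^ 4 : ℝ)⁻¹ ^ k) atTop (nhdsWithin 0 (Ioi 0)) :=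
    tendsto_nhdsWithin_iff.2
      ⟨tendsto_pow_atTop_nhds_zero_of_lt_one (by positivity) (by norm_num),
        Eventually.of_forall fun k => by simp only [mem_Ioi]; positivity⟩
  obtain ⟨K, hK⟩ := eventually_atTop.1 (hlim.eventually (eventually_lt_of_lt_liminf hc))
  obtain ⟨N, hN⟩ := ENNReal.exists_nat_mul_gt hc0.ne' (measure_ne_top μ (ball p 1))
  set k := max K N
  have hden := ENNReal.mul_le_of_le_div (hK k (le_max_left K N)).le
  have hcancel : (10 ^ (4 * n)) ^ k * ENNReal.ofReal (((10 ^ 4 : ℝ)⁻¹ ^ k) ^ n) = 1 := by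
    rw [← ENNReal.ofReal_one, ← ENNReal.ofReal_ofNat 10, ← ENNReal.ofReal_pow (by positivity),
      ← ENNReal.ofReal_pow (by positivity), ← ENNReal.ofReal_mul (by positivity)]
    congr 1
    rw [← pow_mul _ k n, mul_comm k n, pow_mul _ n k, ← mul_pow, pow_mul, ← mul_pow]
    norm_num
  have hpow : (k : ℝ≥0∞) ≤ (10 ^ (4 * 3)) ^ k := by
    exact_mod_cast (Nat.lt_pow_self (by norm_num : 1 < 10 ^ (4 * 3))).le
  refine (hN.trans_le ?_).false
  calc (N : ℝ≥0∞) * c ≤ k * c := by gcongr; exact le_max_right K N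
    _ ≤ (10 ^ (4 * 3)) ^ k * c := by gcongr
    _ = (10 ^ (4 * 3)) ^ k * ((10 ^ (4 * n)) ^ k *
          ENNReal.ofReal (((10 ^ 4 : ℝ)⁻¹ ^ k) ^ n)) * c := by rw [hcancel, mul_one]
    _ = (10 ^ (4 * (n + 3))) ^ k * (c * ENNReal.ofReal (((10 ^ 4 : ℝ)⁻¹ ^ k) ^ n)) := by ring
    _ ≤ (10 ^ (4 * (n + 3))) ^ k * μ (ball p ((10 ^ 4 : ℝ)⁻¹ ^ k)) := by gcongr
    _ ≤ μ (ball p 1) := decay k fun j _ => not_le.2 (hfail j)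

/-- A point of positive lower density is the centre of a good ball. -/
theorem exists_isGoodBall_of_liminf_pos {X : Type*} [MetricSpace X] [MeasurableSpace X]
    (μ : Measure X) [IsFiniteMeasure μ] (n : ℕ) (p : X)
    (hp : 0 < liminf (fun ε : ℝ => μ (ball p ε) / ENNReal.ofReal (ε ^ n))
      (nhdsWithin 0 (Ioi 0))) :
    ∃ R : ℝ, 0 < R ∧ IsGoodBall μ n p R := by
  obtain ⟨k, hgrowth, hdecay⟩ := exists_measure_ball_le_of_liminf_pos μ n p hp
  set ε : ℝ := (10 ^ 4 : ℝ)⁻¹ ^ k with hε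
  have hε0 : 0 < ε := by positivity
  have hε1 : ε ≤ 1 := pow_le_one₀ (by positivity) (by norm_num)
  refine ⟨ε / 100, by positivity, ?_, ?_, by linarith⟩
  · rw [show 100 * (ε / 100) = ε by ring,
      show ε / 100 / 100 = (10 ^ 4 : ℝ)⁻¹ ^ (k + 1) by rw [pow_succ, ← hε]; ring]
    exact hgrowth
  · have hscale : (10 : ℝ≥0∞) ^ (2 * n + 6) * ENNReal.ofReal (ε / 100) ^ (n + 3) *
        (10 ^ (4 * (n + 3))) ^ k = 1 := by
      rw [← ENNReal.ofReal_one, ← ENNReal.ofReal_ofNat 10, ← ENNReal.ofReal_pow (by positivity),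
        ← ENNReal.ofReal_pow (by positivity), ← ENNReal.ofReal_pow (by positivity),
        ← ENNReal.ofReal_pow (by positivity), ← ENNReal.ofReal_mul (by positivity),
        ← ENNReal.ofReal_mul (by positivity)]
      congr 1
      calc (10 : ℝ) ^ (2 * n + 6) * (ε / 100) ^ (n + 3) * (10 ^ (4 * (n + 3))) ^ k
          = (10 ^ 2 * (ε / 100) * (10 ^ 4) ^ k) ^ (n + 3) := by
            rw [mul_pow, mul_pow, show 2 * n + 6 = 2 * (n + 3) by ring, pow_mul, pow_mul _ 4,
              pow_right_comm _ k]
        _ = ((10 ^ 4 : ℝ)⁻¹ ^ k * (10 ^ 4) ^ k) ^ (n + 3) := by rw [hε]; ring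
        _ = 1 := by rw [← mul_pow]; norm_num
    calc μ (ball p (ε / 100)) ≤ μ (ball p ε) := measure_mono (ball_subset_ball (by linarith))
      _ = 10 ^ (2 * n + 6) * ENNReal.ofReal (ε / 100) ^ (n + 3) *
            ((10 ^ (4 * (n + 3))) ^ k * μ (ball p ε)) := by
          rw [← mul_assoc, hscale, one_mul]
      _ ≤ 10 ^ (2 * n + 6) * ENNReal.ofReal (ε / 100) ^ (n + 3) * V1 μ := by
          gcongr
          exact hdecay.trans (le_iSup (fun q : X => μ (ball q 1)) p)
      _ = 10 ^ (2 * n + 6) * V1 μ * ENNReal.ofReal (ε / 100) ^ (n + 3) := by ring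

/-- a compact metric space with finite Borel measure whose lower density is
positive at every point admits a finite good cover: finitely many good balls `B(pᵢ, rᵢ)` such
that the balls `B(pᵢ, rᵢ/2)` cover `X` and the balls `B(pᵢ, rᵢ/6)` are pairwise disjoint. -/
theorem statement1 {X : Type*} [MetricSpace X] [CompactSpace X]
    [MeasurableSpace X] [BorelSpace X]
    (n : ℕ) (hn : 1 ≤ n) (μ : Measure X) (hfin : μ Set.univ < ⊤)
    (hp : ∀ p : X, 0 < Filter.liminf
      (fun ε : ℝ => μ (Metric.ball p ε) / ENNReal.ofReal (ε ^ n))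
      (nhdsWithin 0 (Set.Ioi 0))) :
    ∃ (D : ℕ) (p : Fin D → X) (r : Fin D → ℝ),
      (∀ i, 0 < r i ∧ IsGoodBall μ n (p i) (r i)) ∧
      (∀ x : X, ∃ i, x ∈ Metric.ball (p i) (r i / 2)) ∧
      Pairwise fun i j =>
        Disjoint (Metric.ball (p i) (r i / 6)) (Metric.ball (p j) (r j / 6)) := by
  have : IsFiniteMeasure μ := ⟨hfin⟩
  choose r hr0 hr using fun p => exists_isGoodBall_of_liminf_pos μ n p (hp p)
  have hr6 : ∀ p, 0 < r p / 6 := fun p => by linarith [hr0 p]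
  obtain ⟨t, -, ht⟩ := (isCompact_univ (X := X)).elim_nhds_subcover
    (fun p => ball p (r p / 6)) fun p _ => ball_mem_nhds p (hr6 p)
  obtain ⟨u, -, hdisj, hmeet⟩ := Finset.exists_disjoint_subfamily_meeting
    (fun p => ball p (r p / 6)) r (fun p => nonempty_ball.2 (hr6 p)) t
  let e := u.equivFin.symm
  refine ⟨u.card, fun i => e i, fun i => r (e i), fun i => ⟨hr0 _, hr _⟩, fun x => ?_,
    fun i j hij => hdisj (e i).2 (e j).2 fun h => hij (e.injective (Subtype.ext h))⟩
  obtain ⟨a, hat, hxa⟩ := mem_iUnion₂.1 (ht (mem_univ x))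
  obtain ⟨b, hbu, hab, hle⟩ := hmeet a hat
  obtain ⟨y, hya, hyb⟩ := not_disjoint_iff.1 hab
  obtain ⟨i, hi⟩ := e.surjective ⟨b, hbu⟩
  refine ⟨i, ?_⟩
  simp only [hi, mem_ball] at hxa hya hyb ⊢
  linarith [dist_triangle4_right x b a y, dist_triangle x a b, dist_triangle a y b,
    dist_comm a y]
end

section
/- Suppose X is a proper metric space (all closed bounded subsets are compact), μ is finite on bounded sets, V(1) < ∞, and for every compact set K ⊆ X there exist constants r_K > 0 and c_K > 0 such that μ(B(p, s)) ≥ c_K · s^n for all p ∈ K and all 0 < s ≤ r_K (as holds for a complete Riemannian n-manifold with its volume measure). Then X admits a countable good cover that is locally finite, i.e., only finitely many balls of the cover meet any given compact subset of X. -/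
open Metric MeasureTheory ENNReal Filter Set

/-- The centred ball of radius `R` about `p` has reasonable growth. -/
def HasReasonableGrowth {X : Type*} [MetricSpace X] [MeasurableSpace X]
    (μ : Measure X) (n : ℕ) (p : X) (R : ℝ) : Prop :=
  μ (ball p (100 * R)) ≤ 10 ^ (4 * (n + 3)) * μ (ball p (R / 100))

/-- The scales `10⁻² · 10⁻⁴ᵏ` at which good balls are looked for. -/
noncomputable def goodScale (k : ℕ) : ℝ := (1 / 10 ^ 4) ^ k / 100

lemma goodScale_pos (k : ℕ) : 0 < goodScale k := by
  unfold goodScale; positivity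

lemma goodScale_antitone : Antitone goodScale := by
  intro a b h
  exact div_le_div_of_nonneg_right
    (pow_le_pow_of_le_one (by norm_num) (by norm_num) h) (by norm_num)

lemma goodScale_le (k : ℕ) : goodScale k ≤ 1 / 100 := by
  simpa [goodScale] using goodScale_antitone (Nat.zero_le k)

lemma measure_ball_le_of_not_hasReasonableGrowth {X : Type*} [MetricSpace X] [MeasurableSpace X]
    {μ : Measure X} {n : ℕ} {p : X} {k : ℕ}
    (h : ∀ j < k, ¬ HasReasonableGrowth μ n p (goodScale j)) :
    μ (ball p (100 * goodScale k)) ≤ V1 μ * ENNReal.ofReal (100 * goodScale k) ^ (n + 3) := by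
  induction k with
  | zero => simpa [goodScale, V1] using le_iSup (fun p : X => μ (ball p 1)) p
  | succ k ih =>
    have hs : 100 * goodScale (k + 1) = goodScale k / 100 := by
      simp only [goodScale, pow_succ]; ring
    have ht : goodScale k / 100 = (1 / 10 ^ 4) * (100 * goodScale k) := by ring
    have hfail := h k (Nat.lt_succ_self k)
    rw [HasReasonableGrowth, not_le] at hfail
    have hle := hfail.le.trans (ih fun j hj => h j (hj.trans (Nat.lt_succ_self k)))
    have hc : ENNReal.ofReal (1 / 10 ^ 4) = (10 ^ 4)⁻¹ := by
      rw [one_div, ENNReal.ofReal_inv_of_pos (by norm_num), ENNReal.ofReal_pow (by norm_num)]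
      norm_num
    rw [hs, ← ENNReal.mul_le_mul_iff_right (a := (10 : ℝ≥0∞) ^ (4 * (n + 3)))
      (by positivity) (by finiteness)]
    refine hle.trans (le_of_eq ?_)
    rw [ht, ENNReal.ofReal_mul (p := 1 / 10 ^ 4) (by norm_num), hc, mul_pow,
      ← ENNReal.inv_pow, ← pow_mul, mul_left_comm (V1 μ), ← mul_assoc,
      ENNReal.mul_inv_cancel (by positivity) (by finiteness), one_mul]

lemma isGoodBall_of_hasReasonableGrowth {X : Type*} [MetricSpace X] [MeasurableSpace X]
    {μ : Measure X} {n : ℕ} {p : X} {k : ℕ}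
    (hk : HasReasonableGrowth μ n p (goodScale k))
    (h : ∀ j < k, ¬ HasReasonableGrowth μ n p (goodScale j)) :
    IsGoodBall μ n p (goodScale k) := by
  refine ⟨hk, ?_, goodScale_le k⟩
  have hpos := goodScale_pos k
  calc μ (ball p (goodScale k)) ≤ μ (ball p (100 * goodScale k)) :=
        measure_mono (ball_subset_ball (by linarith))
    _ ≤ V1 μ * ENNReal.ofReal (100 * goodScale k) ^ (n + 3) :=
        measure_ball_le_of_not_hasReasonableGrowth h
    _ = 10 ^ (2 * n + 6) * V1 μ * ENNReal.ofReal (goodScale k) ^ (n + 3) := by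
        have h100 : ENNReal.ofReal 100 = 10 ^ 2 := by norm_num
        rw [ENNReal.ofReal_mul (by norm_num), h100, mul_pow, ← pow_mul]
        ring

lemma exists_forall_hasReasonableGrowth {X : Type*} [MetricSpace X] [MeasurableSpace X]
    {μ : Measure X} {n : ℕ} (hV : V1 μ < ⊤) {K : Set X}
    {r c : ℝ} (hr : 0 < r) (hc : 0 < c)
    (hK : ∀ p ∈ K, ∀ s : ℝ, 0 < s → s ≤ r → ENNReal.ofReal (c * s ^ n) ≤ μ (ball p s)) :
    ∃ N, ∀ p ∈ K, ∃ k ≤ N, HasReasonableGrowth μ n p (goodScale k) := by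
  have hv : 0 ≤ (V1 μ).toReal := ENNReal.toReal_nonneg
  obtain ⟨N, hN⟩ := exists_pow_lt_of_lt_one (lt_min hr (div_pos hc (by positivity :
    0 < (V1 μ).toReal + 1))) (by norm_num : (1 / 10 ^ 4 : ℝ) < 1)
  refine ⟨N, fun p hp => ?_⟩
  by_contra! h
  have hs : 100 * goodScale N = (1 / 10 ^ 4) ^ N := by rw [goodScale]; ring
  have hle := measure_ball_le_of_not_hasReasonableGrowth (k := N) fun j hj => h j hj.le
  rw [hs] at hle
  have hs0 : (0 : ℝ) < (1 / 10 ^ 4) ^ N := by positivity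
  have hs1 : ((1 : ℝ) / 10 ^ 4) ^ N ≤ 1 := pow_le_one₀ (by norm_num) (by norm_num)
  generalize ((1 : ℝ) / 10 ^ 4) ^ N = s at *
  obtain ⟨hsr, hsc⟩ := lt_min_iff.1 hN
  rw [lt_div_iff₀ (by positivity)] at hsc
  have hle' := (hK p hp s hs0 hsr.le).trans hle
  rw [← ENNReal.ofReal_toReal hV.ne, ← ENNReal.ofReal_pow hs0.le, ← ENNReal.ofReal_mul hv,
    ENNReal.ofReal_le_ofReal_iff (by positivity), pow_add, mul_left_comm, mul_comm c] at hle'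
  have hle'' := le_of_mul_le_mul_left hle' (by positivity)
  have hs3 : s ^ 3 ≤ s := pow_le_of_le_one hs0.le hs1 (by norm_num)
  nlinarith [mul_le_mul_of_nonneg_left hs3 hv]

lemma exists_isGoodBall_radius {X : Type*} [MetricSpace X] [MeasurableSpace X]
    {μ : Measure X} {n : ℕ} (hV : V1 μ < ⊤)
    (hlow : ∀ K : Set X, IsCompact K → ∃ rK cK : ℝ, 0 < rK ∧ 0 < cK ∧
      ∀ p ∈ K, ∀ s : ℝ, 0 < s → s ≤ rK → ENNReal.ofReal (cK * s ^ n) ≤ μ (ball p s)) :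
    ∃ R : X → ℝ, (∀ p, 0 < R p ∧ IsGoodBall μ n p (R p)) ∧
      ∀ K, IsCompact K → ∃ ρ > 0, ∀ p ∈ K, ρ ≤ R p := by
  classical
  have hbound : ∀ K : Set X, IsCompact K →
      ∃ N, ∀ p ∈ K, ∃ k ≤ N, HasReasonableGrowth μ n p (goodScale k) := fun K hK => by
    obtain ⟨r, c, hr, hc, h⟩ := hlow K hK
    exact exists_forall_hasReasonableGrowth hV hr hc h
  have hex : ∀ p, ∃ k, HasReasonableGrowth μ n p (goodScale k) := fun p => by
    obtain ⟨N, hN⟩ := hbound {p} isCompact_singleton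
    obtain ⟨k, -, hk⟩ := hN p rfl
    exact ⟨k, hk⟩
  refine ⟨fun p => goodScale (Nat.find (hex p)), fun p => ⟨goodScale_pos _,
    isGoodBall_of_hasReasonableGrowth (Nat.find_spec (hex p)) fun j => Nat.find_min (hex p)⟩,
    fun K hK => ?_⟩
  obtain ⟨N, hN⟩ := hbound K hK
  refine ⟨goodScale N, goodScale_pos N, fun p hp => goodScale_antitone ?_⟩
  obtain ⟨k, hkN, hk⟩ := hN p hp
  exact (Nat.find_min' (hex p) hk).trans hkN

lemma finite_of_pairwiseDisjoint_ball {X : Type*} [MetricSpace X]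
    {K u : Set X} (hK : IsCompact K) {ρ : ℝ} (hρ : 0 < ρ)
    {R : X → ℝ} (hR : ∀ p ∈ K, ρ ≤ R p) (hu : u.PairwiseDisjoint fun p => ball p (R p)) :
    (u ∩ K).Finite := by
  obtain ⟨t, -, ht, hcov⟩ := hK.finite_cover_balls hρ
  have hmem : ∀ x ∈ u ∩ K, ∃ y ∈ t, x ∈ ball y ρ := fun x hx => by
    simpa using hcov hx.2
  choose! f hft hf using hmem
  refine ht.of_injOn (f := f) hft fun x hx y hy hxy => hu.elim_set hx.1 hy.1 (f x) ?_ ?_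
  · exact ball_subset_ball (hR x hx.2) (mem_ball_comm.1 (hf x hx))
  · rw [hxy]
    exact ball_subset_ball (hR y hy.2) (mem_ball_comm.1 (hf y hy))

/-- a proper metric space, with a Borel measure finite on bounded sets,
`V(1) < ∞`, and a uniform lower volume bound `μ(B(p,s)) ≥ c_K s^n` on every compact set `K`,
admits a countable, locally finite good cover. -/
theorem statement2 {X : Type*} [MetricSpace X] [ProperSpace X]
    [MeasurableSpace X] [BorelSpace X]
    (n : ℕ) (hn : 1 ≤ n) (μ : Measure X)
    (hbdd : ∀ s : Set X, Bornology.IsBounded s → μ s < ⊤)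
    (hV : V1 μ < ⊤)
    (hlow : ∀ K : Set X, IsCompact K → ∃ rK cK : ℝ, 0 < rK ∧ 0 < cK ∧
      ∀ p ∈ K, ∀ s : ℝ, 0 < s → s ≤ rK → ENNReal.ofReal (cK * s ^ n) ≤ μ (Metric.ball p s)) :
    ∃ (ι : Type) (_ : Countable ι) (p : ι → X) (r : ι → ℝ),
      (∀ i, 0 < r i ∧ IsGoodBall μ n (p i) (r i)) ∧
      (∀ x : X, ∃ i, x ∈ Metric.ball (p i) (r i / 2)) ∧
      (Pairwise fun i j =>
        Disjoint (Metric.ball (p i) (r i / 6)) (Metric.ball (p j) (r j / 6))) ∧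
      (∀ K : Set X, IsCompact K →
        {i : ι | (Metric.ball (p i) (r i) ∩ K).Nonempty}.Finite) := by
  obtain ⟨R, hR, hRK⟩ := exists_isGoodBall_radius hV hlow
  obtain ⟨u, -, hdisj, hcov⟩ := Vitali.exists_disjoint_subfamily_covering_enlargement
    (fun p : X => ball p (R p / 6)) univ R 2 one_lt_two (fun p _ => (hR p).1.le) (1 / 100)
    (fun p _ => (hR p).2.2.2) (fun p _ => nonempty_ball.2 (by linarith [(hR p).1]))
  have hcount : u.Countable := hdisj.countable_of_isOpen (fun _ _ => isOpen_ball)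
    (fun p _ => nonempty_ball.2 (by linarith [(hR p).1]))
  have := hcount.to_subtype
  let e := equivShrink.{0} u
  refine ⟨Shrink.{0} u, e.symm.injective.countable, fun i => e.symm i, fun i => R (e.symm i),
    fun i => hR _, fun x => ?_, fun i j hij => ?_, fun K hK => ?_⟩
  · obtain ⟨y, hy, ⟨z, hzx, hzy⟩, hxy⟩ := hcov x (mem_univ x)
    refine ⟨e ⟨y, hy⟩, ?_⟩
    simp only [Equiv.symm_apply_apply]
    rw [mem_ball] at hzx hzy ⊢
    linarith [dist_triangle_left x y z]
  · exact hdisj (e.symm i).2 (e.symm j).2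
      (Subtype.coe_injective.ne (e.symm.injective.ne hij))
  · obtain ⟨ρ, hρ, hρR⟩ := hRK _ (hK.cthickening (r := 1))
    have hfin : (u ∩ cthickening 1 K).Finite :=
      finite_of_pairwiseDisjoint_ball (hK.cthickening (r := 1)) (by positivity : 0 < ρ / 6)
        (fun p hp => by linarith [hρR p hp]) hdisj
    refine Finite.of_injOn (f := fun i => (e.symm i : X)) ?_
      (Subtype.coe_injective.comp e.symm.injective).injOn hfin
    rintro i ⟨z, hz, hzK⟩
    refine ⟨(e.symm i).2, mem_cthickening_of_dist_le _ z 1 K hzK ?_⟩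
    rw [mem_ball, dist_comm] at hz
    linarith [(hR (e.symm i : X)).2.2.2]
end

section
/- Suppose V(1) < ∞, μ(B) > 0 for every ball B of positive radius, and {B_i}_{i ∈ I} is a finite good cover of X. Then there exist constants α(n) > 0 and γ(n) > 0, depending only on n, such that for every open set U ⊆ X, every 0 < w < 1/100, and every λ ≥ 0: μ(M_U(γ(n) · log(1/w) + λ)) ≤ e^{-α(n) · λ} · μ(N_w(U)). -/
open Metric MeasureTheory ENNReal Filter Set

/-- The multiplicity function of the family of balls `{B(pᵢ, rᵢ)}`:
`m(x)` is the number of balls of the family containing `x`. -/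
noncomputable def mult {X : Type*} [MetricSpace X] {D : ℕ}
    (p : Fin D → X) (r : Fin D → ℝ) (x : X) : ℕ :=
  Set.ncard {i : Fin D | x ∈ Metric.ball (p i) (r i)}

/-- Exponential integrability of the multiplicity of a finite family of sets `B i`, ordered by
size `r i`, under a Carleson packing condition with respect to sets `E i`. -/
theorem setLIntegral_prod_le {X ι : Type*} [MeasurableSpace X] [DecidableEq ι] (μ : Measure X)
    (B E : ι → Set X) (r : ι → ℝ) (hB : ∀ i, MeasurableSet (B i)) (t : ℝ≥0∞)
    (h : ∀ (j : ι) (S : Finset ι), (∀ i ∈ S, r i ≤ r j ∧ (B j ∩ B i).Nonempty) →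
      t * (μ (B j) + ∑ i ∈ S, μ (E i)) ≤ μ (E j)) (S : Finset ι) :
    ∀ A : Set X, MeasurableSet A → ∀ Q : Finset ι,
      (∀ i ∈ S, (A ∩ B i).Nonempty → i ∈ Q) → Q ⊆ S →
      ∫⁻ x in A, ∏ i ∈ S, (1 + (B i).indicator (fun _ => t) x) ∂μ ≤
        μ A + ∑ i ∈ Q, μ (E i) := by
  classical
  induction S using Finset.induction_on_max_value r with
  | empty => intro A _ Q _ hQ; simp
  | insert j S hj hmax ih =>
    intro A hA Q hQ hQS
    have hmeas : Measurable fun x => ∏ i ∈ S, (1 + (B i).indicator (fun _ => t) x) :=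
      Finset.measurable_fun_prod _ fun i _ =>
        (measurable_const.indicator (hB i)).const_add _
    have hsplit : ∫⁻ x in A, ∏ i ∈ insert j S, (1 + (B i).indicator (fun _ => t) x) ∂μ =
        ∫⁻ x in A, ∏ i ∈ S, (1 + (B i).indicator (fun _ => t) x) ∂μ +
        t * ∫⁻ x in A ∩ B j, ∏ i ∈ S, (1 + (B i).indicator (fun _ => t) x) ∂μ := by
      rw [← lintegral_const_mul _ hmeas, Set.inter_comm, ← Measure.restrict_restrict (hB j),
        ← lintegral_indicator (hB j), ← lintegral_add_left hmeas]
      refine lintegral_congr fun x => ?_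
      rw [Finset.prod_insert hj]
      by_cases hx : x ∈ B j <;> simp [hx, add_mul]
    rw [hsplit]
    have h1 := ih A hA (Q.erase j)
      (fun i hi hne => Finset.mem_erase.2 ⟨fun e => hj (e ▸ hi),
        hQ i (Finset.mem_insert_of_mem hi) hne⟩)
      (fun i hi => Finset.mem_of_mem_insert_of_ne (hQS (Finset.mem_of_mem_erase hi))
        (Finset.ne_of_mem_erase hi))
    rcases (A ∩ B j).eq_empty_or_nonempty with hemp | hne
    · simp only [hemp, Measure.restrict_empty, lintegral_zero_measure, mul_zero, add_zero]
      refine h1.trans ?_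
      gcongr
      exact Finset.erase_subset _ _
    · have hjQ : j ∈ Q := hQ j (Finset.mem_insert_self _ _) hne
      have h2 := ih (B j) (hB j) (S.filter fun i => (B j ∩ B i).Nonempty)
        (fun i hi hne => Finset.mem_filter.2 ⟨hi, hne⟩) (Finset.filter_subset _ _)
      have h3 := h j (S.filter fun i => (B j ∩ B i).Nonempty)
        (fun i hi => ⟨hmax i (Finset.mem_filter.1 hi).1, (Finset.mem_filter.1 hi).2⟩)
      have h4 : t * ∫⁻ x in A ∩ B j, ∏ i ∈ S, (1 + (B i).indicator (fun _ => t) x) ∂μ ≤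
          μ (E j) := by
        refine le_trans ?_ h3
        gcongr
        exact (lintegral_mono_set Set.inter_subset_right).trans h2
      rw [← Finset.sum_erase_add _ _ hjQ, ← add_assoc]
      exact add_le_add h1 h4

/-- The number of balls of comparable radius through a point is bounded by the doubling constant. -/
theorem card_le_of_comparable_radius {X ι : Type*} [MetricSpace X] [MeasurableSpace X]
    [BorelSpace X] (μ : Measure X) (p : ι → X) (r : ι → ℝ) (C : ℕ)
    (hC : ∀ i, μ (ball (p i) (100 * r i)) ≤ C * μ (ball (p i) (r i / 100)))
    (hd : Pairwise fun i j => Disjoint (ball (p i) (r i / 100)) (ball (p j) (r j / 100)))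
    (x : X) (s : ℝ) (hpos : 0 < μ (ball x (2 * s))) (hfin : μ (ball x (2 * s)) < ⊤)
    (S : Finset ι) (hS : ∀ i ∈ S, x ∈ ball (p i) (r i) ∧ r i ≤ s ∧ s ≤ 3 * r i) :
    S.card ≤ C := by
  have h1 : ∑ i ∈ S, μ (ball (p i) (r i / 100)) ≤ μ (ball x (2 * s)) := by
    rw [← measure_biUnion_finset (fun i _ j _ hij => hd hij) (fun i _ => measurableSet_ball)]
    refine measure_mono (iUnion₂_subset fun i hi => ?_)
    obtain ⟨hx, h1, h2⟩ := hS i hi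
    refine ball_subset_ball' ?_
    rw [mem_ball, dist_comm] at hx
    linarith [dist_nonneg.trans_lt hx]
  have h2 : (S.card : ℝ≥0∞) * μ (ball x (2 * s)) ≤ C * μ (ball x (2 * s)) := by
    calc (S.card : ℝ≥0∞) * μ (ball x (2 * s)) = ∑ i ∈ S, μ (ball x (2 * s)) := by simp
      _ ≤ ∑ i ∈ S, C * μ (ball (p i) (r i / 100)) := by
        refine Finset.sum_le_sum fun i hi => le_trans (measure_mono ?_) (hC i)
        obtain ⟨hx, h1, h2⟩ := hS i hi
        refine ball_subset_ball' ?_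
        rw [mem_ball] at hx
        linarith [dist_nonneg.trans_lt hx]
      _ ≤ C * μ (ball x (2 * s)) := by rw [← Finset.mul_sum]; gcongr
  exact_mod_cast (ENNReal.mul_le_mul_iff_left hpos.ne' hfin.ne).1 h2

/-- The number of balls of radius larger than `w / 2` through a point is `O(log (1 / w))`. -/
theorem card_large_le {X ι : Type*} [MetricSpace X] [MeasurableSpace X]
    [BorelSpace X] (μ : Measure X) (p : ι → X) (r : ι → ℝ) (C : ℕ)
    (hr : ∀ i, 0 < r i) (hr' : ∀ i, r i ≤ 1 / 100)
    (hC : ∀ i, μ (ball (p i) (100 * r i)) ≤ C * μ (ball (p i) (r i / 100)))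
    (hd : Pairwise fun i j => Disjoint (ball (p i) (r i / 100)) (ball (p j) (r j / 100)))
    (hV : V1 μ < ⊤) (hpos : ∀ (q : X) (R : ℝ), 0 < R → 0 < μ (ball q R))
    (x : X) (w : ℝ) (hw : 0 < w) (hw' : w < 1 / 100)
    (S : Finset ι) (hS : ∀ i ∈ S, x ∈ ball (p i) (r i) ∧ w / 2 < r i) :
    (S.card : ℝ) ≤ 2 * C * Real.log (1 / w) := by
  classical
  have hlog : 2 ≤ Real.log (1 / w) := by
    rw [Real.le_log_iff_exp_le (by positivity)]
    have : Real.exp 2 = Real.exp 1 * Real.exp 1 := by rw [← Real.exp_add]; norm_num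
    have h3 := Real.exp_one_lt_three
    have h0 := Real.exp_pos 1
    have : (100 : ℝ) ≤ 1 / w := by rw [le_div_iff₀ hw]; linarith
    nlinarith
  have hlog2 : Real.log (2 / w) ≤ Real.log (1 / w) + 1 := by
    rw [show 2 / w = 2 * (1 / w) by ring, Real.log_mul (by norm_num) (by positivity)]
    linarith [Real.log_two_lt_d9]
  have hln : ∀ i, 0 ≤ Real.log (1 / r i) := fun i =>
    Real.log_nonneg (by rw [le_div_iff₀ (hr i)]; linarith [hr' i])
  have hexp : ∀ i, Real.exp (-Real.log (1 / r i)) = r i := fun i => by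
    rw [one_div, Real.log_inv, neg_neg, Real.exp_log (hr i)]
  have hbins : ∀ i ∈ S, ⌊Real.log (1 / r i)⌋₊ ∈ Finset.range (⌊Real.log (2 / w)⌋₊ + 1) := by
    intro i hi
    rw [Finset.mem_range, Nat.lt_succ_iff]
    refine Nat.floor_mono (Real.log_le_log (by have := hr i; positivity) ?_)
    rw [div_le_div_iff₀ (hr i) hw]
    linarith [(hS i hi).2]
  have hbin : ∀ k ∈ Finset.range (⌊Real.log (2 / w)⌋₊ + 1),
      (S.filter fun i => ⌊Real.log (1 / r i)⌋₊ = k).card ≤ C := by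
    intro k _
    rcases (S.filter fun i => ⌊Real.log (1 / r i)⌋₊ = k).eq_empty_or_nonempty with he | ⟨i₀, hi₀⟩
    · rw [he, Finset.card_empty]
      exact Nat.zero_le _
    have hcomp : ∀ i ∈ S.filter (fun i => ⌊Real.log (1 / r i)⌋₊ = k),
        x ∈ ball (p i) (r i) ∧ r i ≤ Real.exp (-k) ∧ Real.exp (-k) ≤ 3 * r i := by
      intro i hi
      obtain ⟨hiS, rfl⟩ := Finset.mem_filter.1 hi
      have h1 := Nat.floor_le (hln i)
      have h2 := Nat.lt_floor_add_one (Real.log (1 / r i))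
      refine ⟨(hS i hiS).1, ?_, ?_⟩
      · nth_rw 1 [← hexp i]
        exact Real.exp_le_exp.2 (by linarith)
      · have : Real.exp (-(⌊Real.log (1 / r i)⌋₊ : ℝ)) ≤
            Real.exp (1 + -Real.log (1 / r i)) := Real.exp_le_exp.2 (by linarith)
        rw [Real.exp_add, hexp] at this
        nlinarith [Real.exp_one_lt_three, hr i]
    refine card_le_of_comparable_radius μ p r C hC hd x (Real.exp (-k))
      (hpos _ _ (by positivity)) (lt_of_le_of_lt ?_ hV) _ hcomp
    refine le_trans (measure_mono (ball_subset_ball ?_)) (le_iSup (fun q => μ (ball q 1)) x)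
    linarith [(hcomp i₀ hi₀).2.2, hr' i₀]
  have hcard := Finset.card_le_mul_card_image_of_maps_to hbins C hbin
  rw [Finset.card_range] at hcard
  have hfl : (⌊Real.log (2 / w)⌋₊ : ℝ) ≤ Real.log (2 / w) :=
    Nat.floor_le (Real.log_nonneg (by rw [le_div_iff₀ hw]; linarith))
  have hcard' : (S.card : ℝ) ≤ C * (⌊Real.log (2 / w)⌋₊ + 1) := by exact_mod_cast hcard
  have hC0 : (0 : ℝ) ≤ C := Nat.cast_nonneg C
  nlinarith

/-- Exponential decay for the multiplicity of the balls of radius at most `w / 2`. -/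
theorem setLIntegral_small_le {X ι : Type*} [MetricSpace X] [MeasurableSpace X]
    [BorelSpace X] [DecidableEq ι] (μ : Measure X) (p : ι → X) (r : ι → ℝ) (C : ℕ)
    (hr : ∀ i, 0 < r i)
    (hC : ∀ i, μ (ball (p i) (100 * r i)) ≤ C * μ (ball (p i) (r i / 100)))
    (hd : Pairwise fun i j => Disjoint (ball (p i) (r i / 100)) (ball (p j) (r j / 100)))
    (t : ℝ≥0∞) (ht : t * (C + C) ≤ 1)
    (U : Set X) (hU : IsOpen U) (w : ℝ) (hw : 0 < w)
    (S : Finset ι) (hS : ∀ i ∈ S, r i ≤ w / 2) :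
    ∫⁻ x in U, ∏ i ∈ S, (1 + (ball (p i) (r i)).indicator (fun _ => t) x) ∂μ ≤
      2 * μ (thickening w U) := by
  classical
  have hsum : ∀ (T : Finset ι) (A : Set X), (∀ i ∈ T, ball (p i) (r i / 100) ⊆ A) →
      ∑ i ∈ T, μ (ball (p i) (r i / 100)) ≤ μ A := by
    intro T A hT
    rw [← measure_biUnion_finset (fun i _ j _ hij => hd hij) (fun i _ => measurableSet_ball)]
    exact measure_mono (iUnion₂_subset hT)
  have key := setLIntegral_prod_le μ (fun i => ball (p i) (r i))
    (fun i => ball (p i) (r i / 100)) r (fun i => measurableSet_ball) t ?_ S U hU.measurableSet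
    (S.filter fun i => (U ∩ ball (p i) (r i)).Nonempty)
    (fun i hi hne => Finset.mem_filter.2 ⟨hi, hne⟩) (Finset.filter_subset _ _)
  · refine key.trans ?_
    rw [two_mul]
    refine add_le_add (measure_mono (self_subset_thickening hw U)) (hsum _ _ fun i hi y hy => ?_)
    obtain ⟨hi, u, huU, hu⟩ := Finset.mem_filter.1 hi
    rw [mem_thickening_iff]
    refine ⟨u, huU, ?_⟩
    rw [mem_ball] at hu hy
    have := dist_triangle_right y u (p i)
    linarith [hS i hi, hr i]
  · intro j T hT
    have h1 : μ (ball (p j) (r j)) ≤ C * μ (ball (p j) (r j / 100)) :=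
      (measure_mono (ball_subset_ball (by linarith [hr j]))).trans (hC j)
    have h2 : ∑ i ∈ T, μ (ball (p i) (r i / 100)) ≤ C * μ (ball (p j) (r j / 100)) := by
      refine (hsum T (ball (p j) (100 * r j)) fun i hi => ball_subset_ball' ?_).trans (hC j)
      obtain ⟨hij, y, hyj, hyi⟩ := hT i hi
      rw [mem_ball] at hyj hyi
      have := dist_triangle_left (p i) (p j) y
      linarith [hr j]
    calc t * (μ (ball (p j) (r j)) + ∑ i ∈ T, μ (ball (p i) (r i / 100)))
        ≤ t * (C * μ (ball (p j) (r j / 100)) + C * μ (ball (p j) (r j / 100))) := by gcongr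
      _ = t * (C + C) * μ (ball (p j) (r j / 100)) := by ring
      _ ≤ 1 * μ (ball (p j) (r j / 100)) := by gcongr
      _ = μ (ball (p j) (r j / 100)) := one_mul _

/-- given a finite good cover of `X` (with `V(1) < ∞` and every ball of positive
radius of positive measure), there are constants `α(n), γ(n) > 0` such that for every open set
`U`, every `0 < w < 1/100` and every `λ ≥ 0`,
`μ(M_U(γ·log(1/w) + λ)) ≤ e^{-αλ} · μ(N_w(U))`. -/
theorem statement5 (n : ℕ) (hn : 1 ≤ n) :
    ∃ α γ : ℝ, 0 < α ∧ 0 < γ ∧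
      ∀ (X : Type) [MetricSpace X] [MeasurableSpace X] [BorelSpace X],
      ∀ (μ : Measure X) (D : ℕ) (p : Fin D → X) (r : Fin D → ℝ),
      V1 μ < ⊤ →
      (∀ (q : X) (R : ℝ), 0 < R → 0 < μ (Metric.ball q R)) →
      (∀ i, 0 < r i ∧ IsGoodBall μ n (p i) (r i)) →
      (∀ x : X, ∃ i, x ∈ Metric.ball (p i) (r i / 2)) →
      (Pairwise fun i j =>
        Disjoint (Metric.ball (p i) (r i / 6)) (Metric.ball (p j) (r j / 6))) →
      ∀ U : Set X, IsOpen U → ∀ w l : ℝ, 0 < w → w < 1 / 100 → 0 ≤ l →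
        μ {x ∈ U | γ * Real.log (1 / w) + l ≤ (mult p r x : ℝ)} ≤
          ENNReal.ofReal (Real.exp (-α * l)) * μ (Metric.thickening w U) := by
  classical
  set C : ℕ := 10 ^ (4 * (n + 3)) with hCdef
  have hC0 : (0 : ℝ) < C := by rw [hCdef]; positivity
  set t : ℝ := 1 / (2 * C) with htdef
  have ht : 0 < t := by positivity
  have hα : 0 < Real.log (1 + t) := Real.log_pos (by linarith)
  refine ⟨Real.log (1 + t), 2 * C + 1 / Real.log (1 + t), hα, by positivity, ?_⟩
  intro X _ _ _ μ D p r hV hpos hgood _ hdisj U hU w l hw hw' hl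
  have hr : ∀ i, 0 < r i := fun i => (hgood i).1
  have hgr : ∀ i, μ (ball (p i) (100 * r i)) ≤ C * μ (ball (p i) (r i / 100)) := fun i => by
    simpa [hCdef] using (hgood i).2.1
  have hd : Pairwise fun i j => Disjoint (ball (p i) (r i / 100)) (ball (p j) (r j / 100)) :=
    fun i j hij => (hdisj hij).mono (ball_subset_ball (by linarith [hr i]))
      (ball_subset_ball (by linarith [hr j]))
  have htC : ENNReal.ofReal t * (C + C) ≤ 1 := by
    rw [← ENNReal.ofReal_natCast, ← ENNReal.ofReal_add hC0.le hC0.le,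
      ← ENNReal.ofReal_mul ht.le, ENNReal.ofReal_le_one, htdef]
    apply le_of_eq
    field_simp
    ring
  set S : Finset (Fin D) := Finset.univ.filter fun i => r i ≤ w / 2 with hSdef
  have hint := setLIntegral_small_le μ p r C hr hgr hd _ htC U hU w hw S
    (fun i hi => (Finset.mem_filter.1 hi).2)
  set L := Real.log (1 / w)
  have hL : 1 ≤ L := by
    rw [Real.le_log_iff_exp_le (by positivity), le_div_iff₀ hw]
    nlinarith [Real.exp_one_lt_three, Real.exp_pos 1]
  set F : X → ℝ≥0∞ := fun x =>
    ∏ i ∈ S, (1 + (ball (p i) (r i)).indicator (fun _ => ENNReal.ofReal t) x) with hF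
  have hFval : ∀ x, F x =
      ENNReal.ofReal (Real.exp (Real.log (1 + t) * (S.filter fun i => x ∈ ball (p i) (r i)).card))
      := by
    intro x
    rw [mul_comm, Real.exp_nat_mul, Real.exp_log (by linarith), ENNReal.ofReal_pow (by linarith),
      ENNReal.ofReal_add zero_le_one ht.le, ENNReal.ofReal_one, ← Finset.prod_const,
      Finset.prod_filter]
    refine Finset.prod_congr rfl fun i _ => ?_
    by_cases hx : x ∈ ball (p i) (r i)
    · rw [Set.indicator_of_mem hx, if_pos hx]
    · rw [Set.indicator_of_notMem hx, if_neg hx, add_zero]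
  have hsub : {x ∈ U | (2 * C + 1 / Real.log (1 + t)) * L + l ≤ (mult p r x : ℝ)} ⊆
      {x | ENNReal.ofReal (2 * Real.exp (Real.log (1 + t) * l)) ≤ F x} ∩ U := by
    rintro x ⟨hxU, hx⟩
    refine ⟨?_, hxU⟩
    have hlarge := card_large_le μ p r C hr (fun i => (hgood i).2.2.2) hgr hd hV hpos x w hw hw'
      (Finset.univ.filter fun i => x ∈ ball (p i) (r i) ∧ ¬ r i ≤ w / 2)
      (fun i hi => ⟨(Finset.mem_filter.1 hi).2.1, not_le.1 (Finset.mem_filter.1 hi).2.2⟩)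
    have hm : mult p r x = (S.filter fun i => x ∈ ball (p i) (r i)).card +
        (Finset.univ.filter fun i => x ∈ ball (p i) (r i) ∧ ¬ r i ≤ w / 2).card := by
      have h1 : mult p r x = (Finset.univ.filter fun i => x ∈ ball (p i) (r i)).card := by
        rw [mult, ← Set.ncard_coe_finset]
        congr 1
        ext i
        simp
      rw [h1, ← Finset.card_filter_add_card_filter_not (fun i => r i ≤ w / 2),
        Finset.filter_filter, Finset.filter_filter, hSdef, Finset.filter_filter]
      simp only [and_comm]
    rw [hm, Nat.cast_add] at hx
    have hsmall : 1 / Real.log (1 + t) * L + l ≤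
        ((S.filter fun i => x ∈ ball (p i) (r i)).card : ℝ) := by
      linarith
    rw [Set.mem_ofPred_eq, hFval]
    apply ENNReal.ofReal_le_ofReal
    have h2 : (2 : ℝ) ≤ Real.exp L := by linarith [Real.add_one_le_exp L]
    calc 2 * Real.exp (Real.log (1 + t) * l)
        ≤ Real.exp L * Real.exp (Real.log (1 + t) * l) := by gcongr
      _ = Real.exp (Real.log (1 + t) * (1 / Real.log (1 + t) * L + l)) := by
        rw [← Real.exp_add]
        congr 1
        field_simp
      _ ≤ _ := Real.exp_le_exp.2 (by gcongr)
  have hFm : Measurable F := Finset.measurable_fun_prod _ fun i _ =>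
    (measurable_const.indicator measurableSet_ball).const_add _
  have hmarkov := (mul_meas_ge_le_lintegral (μ := μ.restrict U) hFm
    (ENNReal.ofReal (2 * Real.exp (Real.log (1 + t) * l)))).trans hint
  rw [Measure.restrict_apply' hU.measurableSet, ENNReal.ofReal_mul zero_le_two,
    ENNReal.ofReal_ofNat, mul_assoc,
    ENNReal.mul_le_mul_iff_right two_ne_zero ENNReal.ofNat_ne_top] at hmarkov
  rw [ENNReal.ofReal_mul zero_le_two, ENNReal.ofReal_ofNat] at hsub
  refine (measure_mono hsub).trans ?_
  calc _ = ENNReal.ofReal (Real.exp (-Real.log (1 + t) * l)) *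
        (ENNReal.ofReal (Real.exp (Real.log (1 + t) * l)) * _) := by
        rw [← mul_assoc, ← ENNReal.ofReal_mul (Real.exp_pos _).le, ← Real.exp_add, neg_mul,
          neg_add_cancel, Real.exp_zero, ENNReal.ofReal_one, one_mul]
    _ ≤ _ := by gcongr
end

section
/- Suppose μ(X) < ∞ (so that V(1) < ∞), μ(B) > 0 for every ball B of positive radius, and {B_i}_{i ∈ I} is a finite good cover of X. Then there exist constants C(n) > 0 and α(n) > 0, depending only on n, such that for every λ ≥ 0: μ(M(λ)) ≤ C(n) · e^{-α(n) · λ} · μ(X). -/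
open Metric MeasureTheory ENNReal Filter Set

/-- A ball is controlled by its concentric sixth as soon as the growth condition holds. -/
lemma measure_ball_le_mul_measure_ball_div_six {X : Type*} [PseudoMetricSpace X]
    [MeasurableSpace X] {μ : Measure X} {K : ℝ≥0∞} {c : X} {R : ℝ} (hR : 0 < R)
    (hK : μ (ball c (100 * R)) ≤ K * μ (ball c (R / 100))) :
    μ (ball c R) ≤ K * μ (ball c (R / 6)) :=
  calc μ (ball c R) ≤ μ (ball c (100 * R)) := measure_mono (ball_subset_ball (by linarith))
    _ ≤ K * μ (ball c (R / 100)) := hK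
    _ ≤ K * μ (ball c (R / 6)) := by
      gcongr
      linarith

section GrowthFamily

variable {X ι : Type*} [PseudoMetricSpace X] [MeasurableSpace X] [OpensMeasurableSpace X]
  {μ : Measure X} {K : ℝ≥0∞} {p : ι → X} {r : ι → ℝ}

/-- If the sixths of the balls are disjoint and contained in `U`, the total measure of the balls
is controlled by that of `U`. -/
lemma sum_measure_ball_le (hr : ∀ i, 0 < r i)
    (hK : ∀ i, μ (ball (p i) (100 * r i)) ≤ K * μ (ball (p i) (r i / 100)))
    (hd : Pairwise fun i j => Disjoint (ball (p i) (r i / 6)) (ball (p j) (r j / 6)))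
    (s : Finset ι) {U : Set X} (hU : ∀ i ∈ s, ball (p i) (r i / 6) ⊆ U) :
    ∑ i ∈ s, μ (ball (p i) (r i)) ≤ K * μ U :=
  calc ∑ i ∈ s, μ (ball (p i) (r i)) ≤ ∑ i ∈ s, K * μ (ball (p i) (r i / 6)) :=
        Finset.sum_le_sum fun i _ => measure_ball_le_mul_measure_ball_div_six (hr i) (hK i)
    _ = K * μ (⋃ i ∈ s, ball (p i) (r i / 6)) := by
      rw [← Finset.mul_sum, measure_biUnion_finset (fun i _ j _ hij => hd hij)
        (fun i _ => measurableSet_ball)]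
    _ ≤ K * μ U := by
      gcongr
      exact iUnion₂_subset hU

open Classical in
/-- The balls of the family that meet `B(pₐ, rₐ)` and are no larger have total measure at most a
constant times that of `B(pₐ, rₐ)`. -/
lemma sum_measure_ball_inter_nonempty_le (hr : ∀ i, 0 < r i)
    (hK : ∀ i, μ (ball (p i) (100 * r i)) ≤ K * μ (ball (p i) (r i / 100)))
    (hd : Pairwise fun i j => Disjoint (ball (p i) (r i / 6)) (ball (p j) (r j / 6)))
    (s : Finset ι) (a : ι) (hs : ∀ i ∈ s, r i ≤ r a) :
    ∑ i ∈ s with (ball (p i) (r i) ∩ ball (p a) (r a)).Nonempty, μ (ball (p i) (r i)) ≤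
      K ^ 2 * μ (ball (p a) (r a)) := by
  have ha := hr a
  calc _ ≤ K * μ (ball (p a) (100 * r a)) := by
        refine sum_measure_ball_le hr hK hd _ fun i hi x hx => ?_
        obtain ⟨his, y, hyi, hya⟩ := Finset.mem_filter.1 hi
        have hri := hs i his
        have hi0 := hr i
        rw [mem_ball] at *
        have h1 := dist_triangle x (p i) (p a)
        have h2 := dist_triangle_left (p i) (p a) y
        linarith
    _ ≤ K * (K * μ (ball (p a) (r a / 100))) := by
      gcongr
      exact hK a
    _ ≤ K * (K * μ (ball (p a) (r a))) := by
      gcongr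
      linarith
    _ = K ^ 2 * μ (ball (p a) (r a)) := by ring

/-- The function `x ↦ (1 + t) ^ m(x)`, where `m` is the multiplicity of the family of balls
indexed by `s`. -/
noncomputable def expMult (p : ι → X) (r : ι → ℝ) (t : ℝ≥0∞) (s : Finset ι) (x : X) : ℝ≥0∞ :=
  ∏ i ∈ s, (1 + (ball (p i) (r i)).indicator (fun _ => t) x)

lemma measurable_expMult (t : ℝ≥0∞) (s : Finset ι) : Measurable (expMult p r t s) :=
  Finset.measurable_fun_prod _ fun _ _ =>
    (measurable_const.indicator measurableSet_ball).const_add 1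

lemma setLIntegral_expMult_insert [DecidableEq ι] (t : ℝ≥0∞) {s : Finset ι} {a : ι} (ha : a ∉ s)
    (U : Set X) :
    ∫⁻ x in U, expMult p r t (insert a s) x ∂μ =
      ∫⁻ x in U, expMult p r t s x ∂μ +
        t * ∫⁻ x in ball (p a) (r a) ∩ U, expMult p r t s x ∂μ := by
  have h : ∀ x, expMult p r t (insert a s) x = expMult p r t s x +
      (ball (p a) (r a)).indicator (fun x => t * expMult p r t s x) x := by
    intro x
    simp only [expMult, Finset.prod_insert ha, add_mul, one_mul]
    by_cases hx : x ∈ ball (p a) (r a) <;> simp [hx]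
  simp_rw [h]
  rw [lintegral_add_left (measurable_expMult t s), lintegral_indicator measurableSet_ball,
    Measure.restrict_restrict measurableSet_ball, lintegral_const_mul _ (measurable_expMult t s)]

open Classical in
/-- Integral bound for the exponential of the multiplicity, by adding balls in order of
increasing radius. -/
lemma setLIntegral_expMult_le (hr : ∀ i, 0 < r i)
    (hK : ∀ i, μ (ball (p i) (100 * r i)) ≤ K * μ (ball (p i) (r i / 100)))
    (hd : Pairwise fun i j => Disjoint (ball (p i) (r i / 6)) (ball (p j) (r j / 6)))
    {t : ℝ≥0∞} (ht : 2 * t * K ^ 2 ≤ 1) (s : Finset ι) (U : Set X) :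
    ∫⁻ x in U, expMult p r t s x ∂μ ≤
      μ U + 2 * t * ∑ i ∈ s with (ball (p i) (r i) ∩ U).Nonempty, μ (ball (p i) (r i)) := by
  induction s using Finset.induction_on_max_value r generalizing U with
  | empty => simp [expMult]
  | insert a s ha hmax ih =>
    rw [setLIntegral_expMult_insert t ha, Finset.filter_insert]
    split_ifs with hne
    · have hball : ∫⁻ x in ball (p a) (r a) ∩ U, expMult p r t s x ∂μ ≤
          2 * μ (ball (p a) (r a)) :=
        calc _ ≤ ∫⁻ x in ball (p a) (r a), expMult p r t s x ∂μ :=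
              lintegral_mono_set inter_subset_left
          _ ≤ _ := ih _
          _ ≤ μ (ball (p a) (r a)) + 2 * t * (K ^ 2 * μ (ball (p a) (r a))) := by
            gcongr
            exact sum_measure_ball_inter_nonempty_le hr hK hd s a hmax
          _ = μ (ball (p a) (r a)) + 2 * t * K ^ 2 * μ (ball (p a) (r a)) := by
            rw [mul_assoc (2 * t)]
          _ ≤ μ (ball (p a) (r a)) + 1 * μ (ball (p a) (r a)) := by gcongr
          _ = 2 * μ (ball (p a) (r a)) := by ring
      rw [Finset.sum_insert (by simp [ha])]
      calc _ ≤ (μ U + 2 * t * ∑ i ∈ s with (ball (p i) (r i) ∩ U).Nonempty,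
            μ (ball (p i) (r i))) + t * (2 * μ (ball (p a) (r a))) := by
            gcongr
            exact ih U
        _ = _ := by ring
    · rw [not_nonempty_iff_eq_empty.1 hne]
      simpa using ih U

end GrowthFamily

lemma expMult_univ_eq_pow_mult {X : Type*} [MetricSpace X] {D : ℕ} (p : Fin D → X)
    (r : Fin D → ℝ) (t : ℝ≥0∞) (x : X) :
    expMult p r t Finset.univ x = (1 + t) ^ mult p r x := by
  classical
  have h : ∀ i, 1 + (ball (p i) (r i)).indicator (fun _ => t) x =
      if x ∈ ball (p i) (r i) then 1 + t else 1 := by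
    intro i
    by_cases hx : x ∈ ball (p i) (r i) <;> simp [hx]
  simp only [expMult, h]
  rw [← Finset.prod_filter, Finset.prod_const, mult, Set.ncard_eq_toFinset_card',
    Set.toFinset_ofPred]

/-- given a finite good cover of `X` with `μ(X) < ∞` and every ball of positive
radius of positive measure, there are constants `C(n), α(n) > 0` such that for every `λ ≥ 0`,
`μ(M(λ)) ≤ C(n)·e^{-α(n)·λ}·μ(X)`. -/
theorem statement6 (n : ℕ) (hn : 1 ≤ n) :
    ∃ C α : ℝ, 0 < C ∧ 0 < α ∧
      ∀ (X : Type) [MetricSpace X] [MeasurableSpace X] [BorelSpace X],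
      ∀ (μ : Measure X) (D : ℕ) (p : Fin D → X) (r : Fin D → ℝ),
      μ Set.univ < ⊤ →
      (∀ (q : X) (R : ℝ), 0 < R → 0 < μ (Metric.ball q R)) →
      (∀ i, 0 < r i ∧ IsGoodBall μ n (p i) (r i)) →
      (∀ x : X, ∃ i, x ∈ Metric.ball (p i) (r i / 2)) →
      (Pairwise fun i j =>
        Disjoint (Metric.ball (p i) (r i / 6)) (Metric.ball (p j) (r j / 6))) →
      ∀ l : ℝ, 0 ≤ l →
        μ {x : X | l ≤ (mult p r x : ℝ)} ≤
          ENNReal.ofReal (C * Real.exp (-α * l)) * μ Set.univ := by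
  set K : ℝ := 10 ^ (4 * (n + 3)) with hKdef
  have hK1 : 1 ≤ K := one_le_pow₀ (by norm_num)
  have hK0 : 0 < K := by linarith
  set t : ℝ := 1 / (2 * K ^ 2) with htdef
  have ht0 : 0 < t := by positivity
  refine ⟨2, Real.log (1 + t), by norm_num, Real.log_pos (by linarith), ?_⟩
  intro X _ _ _ μ D p r _ _ hgood _ hd l _
  have hKe : (10 : ℝ≥0∞) ^ (4 * (n + 3)) = ENNReal.ofReal K := by
    rw [hKdef, ENNReal.ofReal_pow (by norm_num)]
    norm_num
  have hr : ∀ i, 0 < r i := fun i => (hgood i).1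
  have hgrowth : ∀ i, μ (ball (p i) (100 * r i)) ≤
      ENNReal.ofReal K * μ (ball (p i) (r i / 100)) := fun i => hKe ▸ (hgood i).2.1
  have ht : 2 * ENNReal.ofReal t * ENNReal.ofReal K ^ 2 ≤ 1 := by
    rw [← ENNReal.ofReal_ofNat 2, ← ENNReal.ofReal_pow hK0.le,
      ← ENNReal.ofReal_mul (by norm_num), ← ENNReal.ofReal_mul (by positivity),
      ENNReal.ofReal_le_one, htdef]
    exact le_of_eq (by field_simp)
  have ht' : 2 * ENNReal.ofReal t * ENNReal.ofReal K ≤ 1 := by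
    refine le_trans ?_ ht
    gcongr
    exact le_self_pow₀ (ENNReal.one_le_ofReal.2 hK1) two_ne_zero
  have hint : ∫⁻ x, expMult p r (ENNReal.ofReal t) Finset.univ x ∂μ ≤ 2 * μ univ := by
    classical
    rw [← setLIntegral_univ]
    calc _ ≤ _ := setLIntegral_expMult_le hr hgrowth hd ht _ _
      _ ≤ μ univ + 2 * ENNReal.ofReal t * (ENNReal.ofReal K * μ univ) := by
        gcongr
        exact sum_measure_ball_le hr hgrowth hd _ fun _ _ => subset_univ _
      _ = μ univ + 2 * ENNReal.ofReal t * ENNReal.ofReal K * μ univ := by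
        rw [mul_assoc (2 * ENNReal.ofReal t)]
      _ ≤ μ univ + 1 * μ univ := by gcongr
      _ = 2 * μ univ := by ring
  set E : ℝ := Real.exp (Real.log (1 + t) * l) with hE
  have hE0 : 0 < E := Real.exp_pos _
  have hsub : {x : X | l ≤ (mult p r x : ℝ)} ⊆
      {x | ENNReal.ofReal E ≤ expMult p r (ENNReal.ofReal t) Finset.univ x} := by
    intro x hx
    rw [mem_ofPred_eq] at hx ⊢
    rw [expMult_univ_eq_pow_mult, ← ENNReal.ofReal_one,
      ← ENNReal.ofReal_add zero_le_one ht0.le, ← ENNReal.ofReal_pow (by linarith)]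
    refine ENNReal.ofReal_le_ofReal ?_
    rw [hE, ← Real.rpow_def_of_pos (by linarith), ← Real.rpow_natCast]
    exact Real.rpow_le_rpow_of_exponent_le (by linarith) hx
  have hmarkov : ENNReal.ofReal E * μ {x : X | l ≤ (mult p r x : ℝ)} ≤ 2 * μ univ :=
    calc _ ≤ ENNReal.ofReal E *
          μ {x | ENNReal.ofReal E ≤ expMult p r (ENNReal.ofReal t) Finset.univ x} := by gcongr
      _ ≤ _ := mul_meas_ge_le_lintegral (measurable_expMult _ _) _
      _ ≤ _ := hint
  calc μ {x : X | l ≤ (mult p r x : ℝ)}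
      = ENNReal.ofReal E⁻¹ * (ENNReal.ofReal E * μ {x : X | l ≤ (mult p r x : ℝ)}) := by
        rw [← mul_assoc, ← ENNReal.ofReal_mul (by positivity), inv_mul_cancel₀ hE0.ne',
          ENNReal.ofReal_one, one_mul]
    _ ≤ ENNReal.ofReal E⁻¹ * (2 * μ univ) := by gcongr
    _ = ENNReal.ofReal (2 * Real.exp (-Real.log (1 + t) * l)) * μ univ := by
      rw [neg_mul, Real.exp_neg, ← hE, ENNReal.ofReal_mul (by norm_num), ENNReal.ofReal_ofNat]
      ring
end

section
/- Suppose V(1) < ∞, μ(B) > 0 for every ball B of positive radius, and {B_i}_{i ∈ I} is a finite good cover of X. Then there exist constants α(n) > 0 and γ(n) > 0, depending only on n, such that for every ball B = B(p_i, r_i) of the cover and every λ ≥ 0: μ(M_B(γ(n) · log(1/r_i) + λ)) ≤ e^{-α(n) · λ} · μ(B). -/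
open Metric MeasureTheory ENNReal Filter Set

/-- A telescoping identity: `(1 + t) ^ #S - 1` as a sum over the elements of `S`, each weighted by
the number of its predecessors. -/
theorem one_add_pow_card_eq {ι α : Type*} [DecidableEq ι] [LinearOrder α] (f : ι → α)
    (hf : Function.Injective f) (t : ℝ≥0∞) (S : Finset ι) :
    (1 + t) ^ S.card = 1 + t * ∑ j ∈ S, (1 + t) ^ (S.filter fun k => f k < f j).card := by
  induction S using Finset.induction_on_max_value f with
  | empty => simp
  | insert a s ha hmax ih =>
    have h1 : (insert a s).filter (fun k => f k < f a) = s := by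
      ext k
      simp only [Finset.mem_filter, Finset.mem_insert]
      constructor
      · rintro ⟨rfl | h, hk⟩
        · exact absurd hk (lt_irrefl _)
        · exact h
      · intro hk
        exact ⟨Or.inr hk, lt_of_le_of_ne (hmax k hk) fun h => ha (hf h ▸ hk)⟩
    have h2 : ∀ j ∈ s, (insert a s).filter (fun k => f k < f j) =
        s.filter (fun k => f k < f j) := by
      intro j hj
      rw [Finset.filter_insert, if_neg (not_lt.2 (hmax j hj))]
    rw [Finset.card_insert_of_notMem ha, Finset.sum_insert ha, h1,
      Finset.sum_congr rfl fun j hj => by rw [h2 j hj], pow_succ, mul_add, mul_one, mul_add,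
      mul_comm _ t, add_comm (t * _), ← add_assoc, ← ih]

section Packing

variable {X : Type*} [MetricSpace X] [MeasurableSpace X] {μ : Measure X}
  {D : ℕ} {p : Fin D → X} {r : Fin D → ℝ} {C : ℝ≥0∞}

/-- A ball of reasonable growth is controlled by its concentric sixth. -/
theorem measure_ball_le_sixth (hr : ∀ i, 0 < r i)
    (hA : ∀ i, μ (ball (p i) (100 * r i)) ≤ C * μ (ball (p i) (r i / 100))) (i : Fin D) :
    μ (ball (p i) (r i)) ≤ C * μ (ball (p i) (r i / 6)) := by
  have := hr i
  calc μ (ball (p i) (r i)) ≤ μ (ball (p i) (100 * r i)) :=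
        measure_mono (ball_subset_ball (by linarith))
    _ ≤ C * μ (ball (p i) (r i / 100)) := hA i
    _ ≤ C * μ (ball (p i) (r i / 6)) := by
        gcongr
        linarith

variable [BorelSpace X]

/-- Packing: disjoint small balls inside a ball of reasonable growth. -/
theorem sum_measure_ball_le_s7
    (hr : ∀ i, 0 < r i)
    (hA : ∀ i, μ (ball (p i) (100 * r i)) ≤ C * μ (ball (p i) (r i / 100)))
    (hdis : Pairwise fun i j => Disjoint (ball (p i) (r i / 6)) (ball (p j) (r j / 6)))
    (i : Fin D) (S : Finset (Fin D))
    (hS : ∀ j ∈ S, r j ≤ 3 * r i ∧ (ball (p j) (r j) ∩ ball (p i) (r i)).Nonempty) :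
    ∑ j ∈ S, μ (ball (p j) (r j / 6)) ≤ C * μ (ball (p i) (r i / 100)) := by
  rw [← measure_biUnion_finset (fun a _ b _ hab => hdis hab) fun _ _ => measurableSet_ball]
  refine (measure_mono ?_).trans (hA i)
  refine iUnion₂_subset fun j hj => ball_subset_ball' ?_
  obtain ⟨h, y, hy1, hy2⟩ := hS j hj
  rw [mem_ball'] at hy1
  rw [mem_ball] at hy2
  have := dist_triangle (p j) y (p i)
  have := hr i
  linarith

theorem measurable_one_add_pow_card (t : ℝ≥0∞) (P : Fin D → Prop) [DecidablePred P] :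
    Measurable fun x : X =>
      (1 + t) ^ (Finset.univ.filter fun j => P j ∧ dist x (p j) < r j).card := by
  refine (measurable_of_countable fun k : ℕ => (1 + t) ^ k).comp ?_
  simp only [Finset.card_filter]
  refine Finset.measurable_sum _ fun j _ => Measurable.ite ?_ measurable_const measurable_const
  exact (MeasurableSet.const (P j)).inter (measurableSet_ball : MeasurableSet (ball (p j) (r j)))

/-- Exponential integrability on a ball of the number of balls of the family that are smaller. -/
theorem lintegral_one_add_pow_card_le
    (hr : ∀ i, 0 < r i)
    (hA : ∀ i, μ (ball (p i) (100 * r i)) ≤ C * μ (ball (p i) (r i / 100)))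
    (hdis : Pairwise fun i j => Disjoint (ball (p i) (r i / 6)) (ball (p j) (r j / 6)))
    {t : ℝ≥0∞} (ht : t * (2 * (C * C)) ≤ 1) {α : Type*} [LinearOrder α]
    (f : Fin D → α) (hf : Function.Injective f) (hfr : ∀ i j, f j < f i → r j ≤ r i)
    (i : Fin D) :
    ∫⁻ x in ball (p i) (r i),
      (1 + t) ^ (Finset.univ.filter fun j => f j < f i ∧ dist x (p j) < r j).card ∂μ ≤
      2 * μ (ball (p i) (r i)) := by
  classical
  set g : Fin D → X → ℝ≥0∞ := fun i x =>
    (1 + t) ^ (Finset.univ.filter fun j => f j < f i ∧ dist x (p j) < r j).card with hg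
  have hgm : ∀ i, Measurable (g i) := fun i =>
    measurable_one_add_pow_card t fun j => f j < f i
  have hrec : ∀ i x, g i x = 1 + t * ∑ j ∈ Finset.univ.filter (fun j => f j < f i),
      (ball (p j) (r j)).indicator (g j) x := by
    intro i x
    simp only [hg]
    rw [one_add_pow_card_eq f hf t, ← Finset.filter_filter, Finset.sum_filter (fun j => _ < r j)]
    congr 2
    refine Finset.sum_congr rfl fun j hj => ?_
    rw [Set.indicator_apply]
    refine if_congr Iff.rfl ?_ rfl
    congr 2
    ext k
    simp only [Finset.mem_filter, Finset.mem_univ, true_and] at hj ⊢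
    constructor
    · rintro ⟨⟨_, h2⟩, h3⟩
      exact ⟨h3, h2⟩
    · rintro ⟨h1, h2⟩
      exact ⟨⟨h1.trans hj, h2⟩, h1⟩
  change ∫⁻ x in ball (p i) (r i), g i x ∂μ ≤ _
  induction i using (Finite.wellFounded_of_trans_of_irrefl (Order.Preimage f (· < ·))).induction with
  | h i ih =>
    set S := (Finset.univ.filter (fun j => f j < f i)).filter
      fun j => (ball (p j) (r j) ∩ ball (p i) (r i)).Nonempty with hS
    have hsum : ∑ j ∈ Finset.univ.filter (fun j => f j < f i),
        ∫⁻ x in ball (p i) (r i), (ball (p j) (r j)).indicator (g j) x ∂μ ≤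
        2 * (C * C) * μ (ball (p i) (r i)) := by
      calc _ = ∑ j ∈ S, ∫⁻ x in ball (p i) (r i), (ball (p j) (r j)).indicator (g j) x ∂μ := by
            symm
            refine Finset.sum_filter_of_ne fun j _ hne => ?_
            by_contra hem
            refine hne ?_
            rw [lintegral_indicator measurableSet_ball,
              Measure.restrict_restrict measurableSet_ball, not_nonempty_iff_eq_empty.1 hem]
            simp
        _ ≤ ∑ j ∈ S, 2 * (C * μ (ball (p j) (r j / 6))) := by
            refine Finset.sum_le_sum fun j hj => ?_
            simp only [hS, Finset.mem_filter, Finset.mem_univ, true_and] at hj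
            calc _ ≤ ∫⁻ x, (ball (p j) (r j)).indicator (g j) x ∂μ := setLIntegral_le_lintegral _ _
              _ = ∫⁻ x in ball (p j) (r j), g j x ∂μ := lintegral_indicator measurableSet_ball _
              _ ≤ 2 * μ (ball (p j) (r j)) := ih j hj.1
              _ ≤ _ := by
                gcongr
                exact measure_ball_le_sixth hr hA j
        _ = 2 * C * ∑ j ∈ S, μ (ball (p j) (r j / 6)) := by
            simp only [← mul_assoc, Finset.mul_sum]
        _ ≤ 2 * C * (C * μ (ball (p i) (r i / 100))) := by
            gcongr
            refine sum_measure_ball_le_s7 hr hA hdis i S fun j hj => ?_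
            simp only [hS, Finset.mem_filter, Finset.mem_univ, true_and] at hj
            have := hfr i j hj.1
            have := hr i
            exact ⟨by linarith, hj.2⟩
        _ ≤ 2 * C * (C * μ (ball (p i) (r i))) := by
            have := hr i
            gcongr
            linarith
        _ = _ := by ring
    calc ∫⁻ x in ball (p i) (r i), g i x ∂μ
        = μ (ball (p i) (r i)) + t * ∑ j ∈ Finset.univ.filter (fun j => f j < f i),
          ∫⁻ x in ball (p i) (r i), (ball (p j) (r j)).indicator (g j) x ∂μ := by
          simp only [hrec i]
          rw [lintegral_add_left measurable_const, lintegral_const_mul, lintegral_finsetSum]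
          · simp
          · exact fun j _ => (hgm j).indicator measurableSet_ball
          · exact Finset.measurable_sum _ fun j _ => (hgm j).indicator measurableSet_ball
      _ ≤ μ (ball (p i) (r i)) + t * (2 * (C * C) * μ (ball (p i) (r i))) := by gcongr
      _ = μ (ball (p i) (r i)) + t * (2 * (C * C)) * μ (ball (p i) (r i)) := by ring
      _ ≤ μ (ball (p i) (r i)) + 1 * μ (ball (p i) (r i)) := by gcongr
      _ = 2 * μ (ball (p i) (r i)) := by ring

/-- Only boundedly many balls of comparable radii contain a given point. -/
theorem card_le_of_comparable
    (hr : ∀ i, 0 < r i)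
    (hA : ∀ i, μ (ball (p i) (100 * r i)) ≤ C * μ (ball (p i) (r i / 100)))
    (hdis : Pairwise fun i j => Disjoint (ball (p i) (r i / 6)) (ball (p j) (r j / 6)))
    (hpos : ∀ i, 0 < μ (ball (p i) (r i / 6))) (hfin : ∀ i, μ (ball (p i) (r i / 6)) ≠ ⊤)
    (x : X) (S : Finset (Fin D)) (hx : ∀ j ∈ S, x ∈ ball (p j) (r j))
    (hS : ∀ j ∈ S, ∀ k ∈ S, r j ≤ 3 * r k) : (S.card : ℝ≥0∞) ≤ C := by
  rcases S.eq_empty_or_nonempty with rfl | hne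
  · simp
  obtain ⟨i, hi, hmin⟩ := S.exists_min_image (fun j => μ (ball (p j) (r j / 6))) hne
  refine (ENNReal.mul_le_mul_iff_left (hpos i).ne' (hfin i)).1 ?_
  calc (S.card : ℝ≥0∞) * μ (ball (p i) (r i / 6)) = ∑ j ∈ S, μ (ball (p i) (r i / 6)) := by simp
    _ ≤ ∑ j ∈ S, μ (ball (p j) (r j / 6)) := Finset.sum_le_sum hmin
    _ ≤ C * μ (ball (p i) (r i / 100)) :=
        sum_measure_ball_le_s7 hr hA hdis i S fun j hj => ⟨hS j hj i hi, x, hx j hj, hx i hi⟩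
    _ ≤ C * μ (ball (p i) (r i / 6)) := by
        have := hr i
        gcongr
        linarith

/-- The balls of radius at least `s` containing a given point number at most a constant multiple of
`1 + log (1 / s)`. -/
theorem card_large_le_s7
    (hr : ∀ i, 0 < r i) (hr1 : ∀ i, r i ≤ 1) {K : ℕ}
    (hA : ∀ i, μ (ball (p i) (100 * r i)) ≤ K * μ (ball (p i) (r i / 100)))
    (hdis : Pairwise fun i j => Disjoint (ball (p i) (r i / 6)) (ball (p j) (r j / 6)))
    (hpos : ∀ i, 0 < μ (ball (p i) (r i / 6))) (hfin : ∀ i, μ (ball (p i) (r i / 6)) ≠ ⊤)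
    (x : X) {s : ℝ} (hs : 0 < s) (hs1 : s ≤ 1) (S : Finset (Fin D))
    (hx : ∀ j ∈ S, x ∈ ball (p j) (r j)) (hS : ∀ j ∈ S, s ≤ r j) :
    (S.card : ℝ) ≤ K * (1 + Real.log (1 / s)) := by
  have hnn : ∀ y : ℝ, 0 < y → y ≤ 1 → 0 ≤ Real.log (1 / y) := fun y h0 h1 =>
    Real.log_nonneg (by rw [le_div_iff₀ h0]; linarith)
  have hcard : S.card ≤ K * (Finset.range (⌊Real.log (1 / s)⌋₊ + 1)).card := by
    refine Finset.card_le_mul_card_image_of_maps_to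
      (f := fun j => ⌊Real.log (1 / r j)⌋₊) (fun j hj => ?_) K fun b _ => ?_
    · rw [Finset.mem_range, Nat.lt_succ_iff]
      have := hr j
      have := hS j hj
      exact Nat.floor_le_floor (Real.log_le_log (by positivity) (by gcongr))
    · have := card_le_of_comparable hr hA hdis hpos hfin x
        (S.filter fun j => ⌊Real.log (1 / r j)⌋₊ = b)
        (fun j hj => hx j (Finset.mem_filter.1 hj).1) fun j hj k hk => ?_
      · exact_mod_cast this
      · have hj' := (Nat.floor_eq_iff (hnn _ (hr j) (hr1 j))).1 (Finset.mem_filter.1 hj).2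
        have hk' := (Nat.floor_eq_iff (hnn _ (hr k) (hr1 k))).1 (Finset.mem_filter.1 hk).2
        rw [one_div, Real.log_inv] at hj' hk'
        have hlog : Real.log (r j) ≤ Real.log (Real.exp 1 * r k) := by
          rw [Real.log_mul (Real.exp_pos 1).ne' (hr k).ne', Real.log_exp]
          linarith [hj'.1, hk'.2]
        have h1 := (Real.log_le_log_iff (hr j) (mul_pos (Real.exp_pos 1) (hr k))).1 hlog
        have h2 := Real.exp_one_lt_d9
        have := hr k
        nlinarith
  have hfl := Nat.floor_le (hnn s hs hs1)
  have : (S.card : ℝ) ≤ K * (⌊Real.log (1 / s)⌋₊ + 1) := by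
    rw [Finset.card_range] at hcard
    exact_mod_cast hcard
  refine this.trans (mul_le_mul_of_nonneg_left ?_ K.cast_nonneg)
  linarith

end Packing

/-- given a finite good cover of `X` (with `V(1) < ∞` and every ball of positive
radius of positive measure), there are constants `α(n), γ(n) > 0` such that for every ball
`B = B(pᵢ, rᵢ)` of the cover and every `λ ≥ 0`,
`μ(M_B(γ·log(1/rᵢ) + λ)) ≤ e^{-αλ}·μ(B)`. -/
theorem statement7 (n : ℕ) (hn : 1 ≤ n) :
    ∃ α γ : ℝ, 0 < α ∧ 0 < γ ∧
      ∀ (X : Type) [MetricSpace X] [MeasurableSpace X] [BorelSpace X],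
      ∀ (μ : Measure X) (D : ℕ) (p : Fin D → X) (r : Fin D → ℝ),
      V1 μ < ⊤ →
      (∀ (q : X) (R : ℝ), 0 < R → 0 < μ (Metric.ball q R)) →
      (∀ i, 0 < r i ∧ IsGoodBall μ n (p i) (r i)) →
      (∀ x : X, ∃ i, x ∈ Metric.ball (p i) (r i / 2)) →
      (Pairwise fun i j =>
        Disjoint (Metric.ball (p i) (r i / 6)) (Metric.ball (p j) (r j / 6))) →
      ∀ i : Fin D, ∀ l : ℝ, 0 ≤ l →
        μ {x ∈ Metric.ball (p i) (r i) | γ * Real.log (1 / r i) + l ≤ (mult p r x : ℝ)} ≤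
          ENNReal.ofReal (Real.exp (-α * l)) * μ (Metric.ball (p i) (r i)) := by
  classical
  set K : ℕ := 10 ^ (4 * (n + 3)) with hK
  have hK0 : (0 : ℝ) < K := by rw [hK]; positivity
  set τ : ℝ := 1 / (2 * (K * K)) with hτ
  have hτ0 : 0 < τ := by positivity
  have hL : 0 < Real.log (1 + τ) := Real.log_pos (by linarith)
  refine ⟨Real.log (1 + τ), 2 * K + 1 / Real.log (1 + τ), hL, by positivity, ?_⟩
  intro X _ _ _ μ D p r hV hpos hgood _ hdis i l hl
  have hr : ∀ i, 0 < r i := fun i => (hgood i).1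
  have hr1 : ∀ i, r i ≤ 1 / 100 := fun i => (hgood i).2.2.2
  have hA : ∀ i, μ (ball (p i) (100 * r i)) ≤ (K : ℝ≥0∞) * μ (ball (p i) (r i / 100)) := by
    intro i
    simpa [hK] using (hgood i).2.1
  have hfin : ∀ i, μ (ball (p i) (r i / 6)) ≠ ⊤ := fun i =>
    (((measure_mono (ball_subset_ball (by linarith [hr1 i, hr i]))).trans
      (le_iSup (fun q => μ (ball q 1)) (p i))).trans_lt hV).ne
  set f : Fin D → ℝ ×ₗ Fin D := fun j => toLex (r j, j) with hf
  have hfinj : Function.Injective f := fun a b h => (Prod.ext_iff.1 (toLex_inj.1 h)).2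
  set g : X → ℕ := fun x =>
    (Finset.univ.filter fun j => f j < f i ∧ dist x (p j) < r j).card with hg
  have hlog : 1 ≤ Real.log (1 / r i) := by
    rw [Real.le_log_iff_exp_le (one_div_pos.2 (hr i)), le_div_iff₀ (hr i)]
    nlinarith [Real.exp_one_lt_d9, hr1 i, hr i]
  have hmult : ∀ x, (mult p r x : ℝ) ≤ 2 * K * Real.log (1 / r i) + g x := by
    intro x
    have h1 : mult p r x = (Finset.univ.filter fun j => dist x (p j) < r j).card := by
      rw [mult, ← Set.ncard_coe_finset]
      congr 1
      ext j
      simp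
    have h2 := card_large_le_s7 hr (fun i => (hr1 i).trans (by norm_num)) hA hdis
      (fun i => hpos _ _ (by linarith [hr i])) hfin x (hr i) ((hr1 i).trans (by norm_num))
      (Finset.univ.filter fun j => ¬ f j < f i ∧ dist x (p j) < r j)
      (fun j hj => (Finset.mem_filter.1 hj).2.2) (fun j hj => by
        have := (Finset.mem_filter.1 hj).2.1
        by_contra hlt
        exact this (Prod.Lex.toLex_lt_toLex.2 (Or.inl (not_le.1 hlt))))
    have h3 : mult p r x = g x +
        (Finset.univ.filter fun j => ¬ f j < f i ∧ dist x (p j) < r j).card := by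
      rw [h1, ← Finset.card_filter_add_card_filter_not (fun j => f j < f i), Finset.filter_filter,
        Finset.filter_filter, hg]
      simp only [and_comm]
    rw [h3]
    push_cast
    nlinarith
  have hint := lintegral_one_add_pow_card_le (t := ENNReal.ofReal τ) hr hA hdis (by
    have : (2 * ((K : ℝ≥0∞) * K)) = ENNReal.ofReal (2 * (K * K)) := by
      rw [ENNReal.ofReal_mul zero_le_two, ENNReal.ofReal_mul hK0.le]
      simp
    rw [this, ← ENNReal.ofReal_mul hτ0.le, hτ, one_div_mul_cancel (by positivity)]
    simp) f hfinj (fun i j h => by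
      rcases Prod.Lex.toLex_lt_toLex.1 h with h | h
      · exact h.le
      · exact h.1.le) i
  have hbase : 1 + ENNReal.ofReal τ = ENNReal.ofReal (1 + τ) := by
    rw [ENNReal.ofReal_add zero_le_one hτ0.le, ENNReal.ofReal_one]
  have hsub : {x ∈ ball (p i) (r i) | (2 * K + 1 / Real.log (1 + τ)) * Real.log (1 / r i) + l ≤
      (mult p r x : ℝ)} ⊆
      {x | ENNReal.ofReal (2 * Real.exp (Real.log (1 + τ) * l)) ≤
        (1 + ENNReal.ofReal τ) ^ g x} ∩ ball (p i) (r i) := by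
    rintro x ⟨hxB, hx⟩
    refine ⟨?_, hxB⟩
    have hgx : 1 / Real.log (1 + τ) + l ≤ g x := by
      have := le_mul_of_one_le_right (one_div_pos.2 hL).le hlog
      linarith [hmult x]
    rw [mem_ofPred_eq, hbase, ← ENNReal.ofReal_pow (by positivity)]
    refine ENNReal.ofReal_le_ofReal ?_
    calc 2 * Real.exp (Real.log (1 + τ) * l)
        ≤ Real.exp 1 * Real.exp (Real.log (1 + τ) * l) := by
          gcongr
          linarith [Real.add_one_le_exp 1]
      _ = Real.exp (Real.log (1 + τ) * (1 / Real.log (1 + τ) + l)) := by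
          rw [← Real.exp_add, mul_add, mul_one_div_cancel hL.ne']
      _ ≤ Real.exp (Real.log (1 + τ) * g x) := by gcongr
      _ = (1 + τ) ^ g x := by
          rw [mul_comm, Real.exp_nat_mul, Real.exp_log (by linarith)]
  have hmeas : Measurable fun x => (1 + ENNReal.ofReal τ) ^ g x :=
    measurable_one_add_pow_card _ fun j => f j < f i
  have hmarkov := (mul_meas_ge_le_lintegral (μ := μ.restrict (ball (p i) (r i))) hmeas
    (ENNReal.ofReal (2 * Real.exp (Real.log (1 + τ) * l)))).trans hint
  rw [Measure.restrict_apply' measurableSet_ball, ENNReal.ofReal_mul zero_le_two,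
    ENNReal.ofReal_ofNat, mul_assoc,
    ENNReal.mul_le_mul_iff_right two_ne_zero ENNReal.ofNat_ne_top,
    ← ENNReal.ofReal_ofNat 2, ← ENNReal.ofReal_mul zero_le_two] at hmarkov
  refine (measure_mono hsub).trans ?_
  calc _ = ENNReal.ofReal (Real.exp (-Real.log (1 + τ) * l)) *
        (ENNReal.ofReal (Real.exp (Real.log (1 + τ) * l)) *
          μ ({x | ENNReal.ofReal (2 * Real.exp (Real.log (1 + τ) * l)) ≤
            (1 + ENNReal.ofReal τ) ^ g x} ∩ ball (p i) (r i))) := by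
        rw [← mul_assoc, ← ENNReal.ofReal_mul (Real.exp_pos _).le, ← Real.exp_add]
        simp
    _ ≤ _ := by gcongr
end
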